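/- Let a ground normal logic program over N atoms with R rules be given, with program matrix Q and head matrix D, let I be an interpretation with interpretation vector v, complementary interpretation vector w, and body-truth vector z defined by z i = 1 - min 1 ((Q.mulVec (fun p => 1 - w p)) i). Let hI : Fin N → ℝ be defined by hI j = min 1 ((D.mulVec z) j), let L₁, …, L_O be a finite family of nonempty sets of atoms with indicator rows ℓ_o and external support matrices ES_o, and set u_o = min 1 (ℓ_o ⬝ᵥ (fun j => 1 - v j) + ℓ_o ⬝ᵥ ((ES_o).mulVec z)). Then the combined loss dist(v, hI) + ∑ o, (1 - u_o) (with dist the Euclidean distance) equals 0 if and only if I satisfies the Clark completion of the program and for every o the conjunctive loop formula of L_o holds in I. -/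

import Mathlib

open Matrix

/-- Interpretation vector: indicator of `I`. -/
noncomputable def interpVec {N : ℕ} (I : Finset (Fin N)) : Fin N → ℝ :=
  fun j => if j ∈ I then 1 else 0

/-- Complementary interpretation vector. -/
noncomputable def compVec {N : ℕ} (I : Finset (Fin N)) : Fin N ⊕ Fin N → ℝ :=
  Sum.elim (interpVec I) (fun j => 1 - interpVec I j)

/-- Program matrix of a ground normal logic program (also used for constraints). -/
noncomputable def progMat {N R : ℕ} (pos neg : Fin R → Finset (Fin N)) :
    Matrix (Fin R) (Fin N ⊕ Fin N) ℝ :=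
  fun i => Sum.elim (fun j => if j ∈ pos i then 1 else 0)
                    (fun j => if j ∈ neg i then 1 else 0)

/-- Head matrix of a ground normal logic program. -/
noncomputable def headMat {N R : ℕ} (h : Fin R → Fin N) : Matrix (Fin N) (Fin R) ℝ :=
  fun j i => if h i = j then 1 else 0

/-- The body of rule `i` is satisfied by interpretation `I`. -/
def BodySat {N R : ℕ} (pos neg : Fin R → Finset (Fin N)) (I : Finset (Fin N))
    (i : Fin R) : Prop :=
  pos i ⊆ I ∧ neg i ∩ I = ∅

/-- `I` satisfies the Clark completion of the program. -/
def SatComp {N R : ℕ} (h : Fin R → Fin N) (pos neg : Fin R → Finset (Fin N))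
    (I : Finset (Fin N)) : Prop :=
  ∀ j : Fin N, j ∈ I ↔ ∃ i : Fin R, h i = j ∧ BodySat pos neg I i

instance {N R : ℕ} {pos neg : Fin R → Finset (Fin N)} {I : Finset (Fin N)} {i : Fin R} :
    Decidable (BodySat pos neg I i) :=
  inferInstanceAs (Decidable (_ ∧ _))

/-- Body-truth vector `z`. -/
noncomputable def bodyVec {N R : ℕ} (pos neg : Fin R → Finset (Fin N))
    (I : Finset (Fin N)) : Fin R → ℝ :=
  fun i => 1 - min 1 ((progMat pos neg).mulVec (fun p => 1 - compVec I p) i)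

/-- Indicator row of a set of atoms. -/
noncomputable def indRow {N : ℕ} (L : Finset (Fin N)) : Fin N → ℝ :=
  fun j => if j ∈ L then 1 else 0

/-- Rule `i` is an external support of `L`. -/
def ExtSupport {N R : ℕ} (h : Fin R → Fin N) (pos : Fin R → Finset (Fin N))
    (L : Finset (Fin N)) (i : Fin R) : Prop :=
  h i ∈ L ∧ pos i ∩ L = ∅

instance {N R : ℕ} {h : Fin R → Fin N} {pos : Fin R → Finset (Fin N)}
    {L : Finset (Fin N)} {i : Fin R} : Decidable (ExtSupport h pos L i) :=
  inferInstanceAs (Decidable (_ ∧ _))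

/-- External support matrix of `L`. -/
noncomputable def esMat {N R : ℕ} (h : Fin R → Fin N) (pos : Fin R → Finset (Fin N))
    (L : Finset (Fin N)) : Matrix (Fin N) (Fin R) ℝ :=
  fun j i => if h i = j ∧ ExtSupport h pos L i then 1 else 0

/-- Truncating a finite sum of indicators at `1` computes a disjunction. -/
lemma min_one_sum_indicator {ι : Type*} [Fintype ι] (P : ι → Prop) [DecidablePred P]
    [Decidable (∃ i, P i)] :
    min 1 (∑ i, if P i then (1 : ℝ) else 0) = if ∃ i, P i then 1 else 0 := by
  split_ifs with hP
  · obtain ⟨i, hi⟩ := hP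
    refine min_eq_left ?_
    calc (1 : ℝ) = if P i then 1 else 0 := by simp [hi]
      _ ≤ _ := Finset.single_le_sum (f := fun i => if P i then (1 : ℝ) else 0)
        (fun k _ => by positivity) (Finset.mem_univ i)
  · push Not at hP
    simp [hP]

open scoped Classical in
lemma bodyVec_eq_indicator {N R : ℕ} (pos neg : Fin R → Finset (Fin N)) (I : Finset (Fin N))
    (i : Fin R) : bodyVec pos neg I i = if BodySat pos neg I i then 1 else 0 := by
  have hsum : (progMat pos neg).mulVec (fun p => 1 - compVec I p) i =
      ∑ p, if Sum.elim (fun j => j ∈ pos i ∧ j ∉ I) (fun j => j ∈ neg i ∧ j ∈ I) p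
        then (1 : ℝ) else 0 := by
    rw [mulVec, dotProduct]
    refine Finset.sum_congr rfl fun p _ => ?_
    rcases p with j | j <;> by_cases hI : j ∈ I <;>
      simp [progMat, compVec, interpVec, hI]
  have hiff : BodySat pos neg I i ↔
      ¬ ∃ p, Sum.elim (fun j => j ∈ pos i ∧ j ∉ I) (fun j => j ∈ neg i ∧ j ∈ I) p := by
    simp [BodySat, Finset.subset_iff, Finset.eq_empty_iff_forall_notMem]
  rw [bodyVec, hsum, min_one_sum_indicator]
  simp only [hiff]
  split_ifs <;> simp

lemma min_one_headMat_mulVec_bodyVec {N R : ℕ} (h : Fin R → Fin N)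
    (pos neg : Fin R → Finset (Fin N)) (I : Finset (Fin N)) (j : Fin N) :
    min 1 ((headMat h).mulVec (bodyVec pos neg I) j) =
      if ∃ i, h i = j ∧ BodySat pos neg I i then 1 else 0 := by
  rw [← min_one_sum_indicator, mulVec, dotProduct]
  congr 1
  refine Finset.sum_congr rfl fun i _ => ?_
  by_cases hj : h i = j <;> simp [headMat, bodyVec_eq_indicator, hj]

lemma indRow_vecMul_esMat {N R : ℕ} (h : Fin R → Fin N) (pos : Fin R → Finset (Fin N))
    (L : Finset (Fin N)) (i : Fin R) :
    (indRow L ᵥ* esMat h pos L) i = if ExtSupport h pos L i then 1 else 0 := by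
  by_cases hi : ExtSupport h pos L i
  · simp [Matrix.vecMul, dotProduct, indRow, esMat, hi, hi.1]
  · simp [Matrix.vecMul, dotProduct, esMat, hi]

open scoped Classical in
/-- The truncated loop expression is the truth value of the conjunctive loop formula. -/
lemma min_one_loop_eq_indicator {N R : ℕ} (h : Fin R → Fin N)
    (pos neg : Fin R → Finset (Fin N)) (I L : Finset (Fin N)) :
    min 1 (indRow L ⬝ᵥ (fun j => 1 - interpVec I j) +
        indRow L ⬝ᵥ (esMat h pos L).mulVec (bodyVec pos neg I)) =
      if L ⊆ I → ∃ i, ExtSupport h pos L i ∧ BodySat pos neg I i then 1 else 0 := by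
  have hsum : indRow L ⬝ᵥ (fun j => 1 - interpVec I j) +
        indRow L ⬝ᵥ (esMat h pos L).mulVec (bodyVec pos neg I) =
      ∑ p : Fin N ⊕ Fin R, if Sum.elim (fun j => j ∈ L ∧ j ∉ I)
        (fun i => ExtSupport h pos L i ∧ BodySat pos neg I i) p then (1 : ℝ) else 0 := by
    rw [dotProduct_mulVec, Fintype.sum_sum_type]
    congr 1 <;> refine Finset.sum_congr rfl fun k _ => ?_
    · by_cases hI : k ∈ I <;> simp [indRow, interpVec, hI]
    · by_cases hk : ExtSupport h pos L k <;>
        simp [indRow_vecMul_esMat, bodyVec_eq_indicator, hk]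
  have hiff : (L ⊆ I → ∃ i, ExtSupport h pos L i ∧ BodySat pos neg I i) ↔
      ∃ p : Fin N ⊕ Fin R, Sum.elim (fun j => j ∈ L ∧ j ∉ I)
        (fun i => ExtSupport h pos L i ∧ BodySat pos neg I i) p := by
    rw [Sum.exists, imp_iff_not_or, Finset.not_subset]
    rfl
  rw [hsum, min_one_sum_indicator]
  simp only [hiff]

theorem stmt_13 {N R O : ℕ} (h : Fin R → Fin N) (pos neg : Fin R → Finset (Fin N))
    (I : Finset (Fin N)) (L : Fin O → Finset (Fin N)) (hL : ∀ o, (L o).Nonempty) :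
    Real.sqrt (∑ j : Fin N,
        (interpVec I j - min 1 ((headMat h).mulVec (bodyVec pos neg I) j)) ^ 2) +
      (∑ o : Fin O,
        (1 - min 1 (indRow (L o) ⬝ᵥ (fun j => 1 - interpVec I j) +
          indRow (L o) ⬝ᵥ (esMat h pos (L o)).mulVec (bodyVec pos neg I)))) = 0 ↔
      (SatComp h pos neg I ∧
        ∀ o : Fin O, L o ⊆ I →
          ∃ i : Fin R, ExtSupport h pos (L o) i ∧ BodySat pos neg I i) := by
  classical
  have hloss (o : Fin O) : 0 ≤ 1 - min 1 (indRow (L o) ⬝ᵥ (fun j => 1 - interpVec I j) +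
      indRow (L o) ⬝ᵥ (esMat h pos (L o)).mulVec (bodyVec pos neg I)) :=
    sub_nonneg.2 (min_le_left _ _)
  rw [add_eq_zero_iff_of_nonneg (Real.sqrt_nonneg _) (Finset.sum_nonneg fun o _ => hloss o),
    Real.sqrt_eq_zero (Finset.sum_nonneg fun j _ => sq_nonneg _),
    Finset.sum_eq_zero_iff_of_nonneg fun j _ => sq_nonneg _,
    Finset.sum_eq_zero_iff_of_nonneg fun o _ => hloss o]
  refine and_congr (forall_congr' fun j => ?_) (forall_congr' fun o => ?_)
  · rw [min_one_headMat_mulVec_bodyVec, interpVec]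
    split_ifs <;> simp_all
  · rw [min_one_loop_eq_indicator]
    split_ifs <;> simp_all
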